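/- Let V be a nonempty finite set and let (·,·) be a negative definite symmetric ℤ-valued bilinear form on L := ℤ^V with standard basis {E_v}_{v∈V}, satisfying (E_u,E_v) ≥ 0 for u ≠ v; let the dual graph G (edge between u ≠ v iff (E_u,E_v) > 0) be connected; let Z_K ∈ ℚ^V be the unique vector with (Z_K,E_v) = (E_v,E_v)+2 for all v, and χ(x) := −(x, x−Z_K)/2. Fix a vertex v₀ ∈ V, let Γ₁,…,Γ_k be the connected components of the subgraph of G induced on V∖{v₀}, and let E_{v₀}^* ∈ ℚ^V be the vector with (E_{v₀}^*, E_v) = −1 if v = v₀ and 0 otherwise. Let M_i be the maximum of −χ(l) over cycles l ≥ 0 supported in Γ_i (this maximum exists by negative definiteness), let M := Σ_{i=1}^k M_i, and let m be the minimum of χ over {l ∈ L : l ≥ 0} (which also exists). Then for every integer n > −M − m, the number M is the greatest element of the set { −χ(l) − n·l_{v₀} : l ∈ L, l ≥ 0 } (where l_{v₀} denotes the v₀-coordinate of l), and it is attained by a cycle l with l_{v₀} = 0; equivalently, χ(nE_{v₀}^*) − inf_{l ≥ 0} χ(nE_{v₀}^* + l) = M. -/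

import Mathlib

open Classical

noncomputable section

/-- The rational pairing on `ℚ^V` determined by the integral matrix `M`. -/
def pairQ {V : Type} [Fintype V] (M : Matrix V V ℤ) (x y : V → ℚ) : ℚ :=
  ∑ u, ∑ v, x u * (M u v : ℚ) * y v

/-- The Riemann–Roch expression `χ(x) = −(x, x − Z_K)/2`. -/
def chiQ {V : Type} [Fintype V] (M : Matrix V V ℤ) (ZK : V → ℚ) (x : V → ℚ) : ℚ :=
  - pairQ M x (x - ZK) / 2

/-- Inclusion of integral cycles into `ℚ^V`. -/
def toQ {V : Type} (l : V → ℤ) : V → ℚ := fun v => (l v : ℚ)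

/-- The dual graph: `u ~ v` iff `u ≠ v` and `M u v > 0` (for symmetric `M`). -/
def dualGraph {V : Type} (M : Matrix V V ℤ) : SimpleGraph V :=
  SimpleGraph.fromRel (fun u v => 0 < M u v)

/-- The support `|Z|` of a cycle. -/
def supp {V : Type} (Z : V → ℤ) : Set V := {v | Z v ≠ 0}

/-- The dual graph induced on the support of a cycle. -/
def inducedOnSupp {V : Type} (M : Matrix V V ℤ) (Z : V → ℤ) :
    SimpleGraph (supp Z) :=
  (dualGraph M).induce (supp Z)

/-- The part `Z_c` of a cycle `Z` corresponding to a connected component `c`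
of the dual graph induced on the support of `Z`:  it agrees with `Z` on the
component and vanishes elsewhere. -/
def compCycle {V : Type} (M : Matrix V V ℤ) (Z : V → ℤ)
    (c : (inducedOnSupp M Z).ConnectedComponent) : V → ℤ := fun v =>
  if h : Z v ≠ 0 then
    (if (inducedOnSupp M Z).connectedComponentMk ⟨v, h⟩ = c then Z v else 0)
  else 0

/-- The sum `Σ_i F(Z_i)` of a quantity `F` over the connected components
`Z = Σ_i Z_i` of a cycle. -/
def sumComp {V : Type} [Fintype V] (M : Matrix V V ℤ)
    (F : (V → ℤ) → ℚ) (Z : V → ℤ) : ℚ :=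
  ∑ᶠ c : (inducedOnSupp M Z).ConnectedComponent, F (compCycle M Z c)

end

lemma pairQ_add_left {V : Type} [Fintype V] (M : Matrix V V ℤ) (x y z : V → ℚ) :
    pairQ M (x + y) z = pairQ M x z + pairQ M y z := by
  simp [pairQ, add_mul, Finset.sum_add_distrib]

lemma pairQ_add_right {V : Type} [Fintype V] (M : Matrix V V ℤ) (x y z : V → ℚ) :
    pairQ M x (y + z) = pairQ M x y + pairQ M x z := by
  simp [pairQ, mul_add, Finset.sum_add_distrib]

lemma pairQ_sub_right {V : Type} [Fintype V] (M : Matrix V V ℤ) (x y z : V → ℚ) :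
    pairQ M x (y - z) = pairQ M x y - pairQ M x z := by
  simp [pairQ, mul_sub, Finset.sum_sub_distrib]

lemma pairQ_smul_left {V : Type} [Fintype V] (M : Matrix V V ℤ) (a : ℚ) (x y : V → ℚ) :
    pairQ M (a • x) y = a * pairQ M x y := by
  simp [pairQ, Finset.mul_sum, mul_assoc]

lemma pairQ_sum_left {V : Type} [Fintype V]
    {ι : Type} (M : Matrix V V ℤ) (s : Finset ι) (x : ι → V → ℚ)
    (y : V → ℚ) : pairQ M (∑ i ∈ s, x i) y = ∑ i ∈ s, pairQ M (x i) y := by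
  classical
  induction s using Finset.induction_on with
  | empty => simp [pairQ]
  | insert i s hi ih => rw [Finset.sum_insert hi, Finset.sum_insert hi, pairQ_add_left, ih]

lemma pairQ_sum_right {V : Type} [Fintype V]
    {ι : Type} (M : Matrix V V ℤ) (s : Finset ι) (x : V → ℚ)
    (y : ι → V → ℚ) : pairQ M x (∑ i ∈ s, y i) = ∑ i ∈ s, pairQ M x (y i) := by
  classical
  induction s using Finset.induction_on with
  | empty => simp [pairQ]
  | insert i s hi ih => rw [Finset.sum_insert hi, Finset.sum_insert hi, pairQ_add_right, ih]

lemma pairQ_comm {V : Type} [Fintype V]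
    {M : Matrix V V ℤ} (hsym : ∀ u v, M u v = M v u) (x y : V → ℚ) :
    pairQ M x y = pairQ M y x := by
  unfold pairQ
  rw [Finset.sum_comm]
  refine Finset.sum_congr rfl fun u _ => Finset.sum_congr rfl fun v _ => ?_
  rw [hsym v u]
  ring

lemma pairQ_eq_sum_single {V : Type} [Fintype V] [DecidableEq V] (M : Matrix V V ℤ) (x y : V → ℚ) :
    pairQ M x y = ∑ v, pairQ M x (Pi.single v 1) * y v := by
  unfold pairQ
  rw [Finset.sum_comm]
  refine Finset.sum_congr rfl fun v _ => ?_
  simp [Pi.single_apply, Finset.sum_mul]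

lemma chiQ_add {V : Type} [Fintype V]
    {M : Matrix V V ℤ} (hsym : ∀ u v, M u v = M v u) (ZK x y : V → ℚ) :
    chiQ M ZK (x + y) = chiQ M ZK x + chiQ M ZK y - pairQ M x y := by
  simp only [chiQ, pairQ_add_left, pairQ_sub_right, pairQ_add_right, pairQ_comm hsym y x]
  ring

lemma chiQ_sum_of_pairwise_orthogonal {V : Type} [Fintype V]
    {ι : Type} [Fintype ι] (M : Matrix V V ℤ) (ZK : V → ℚ)
    (x : ι → V → ℚ) (h : ∀ i j, i ≠ j → pairQ M (x i) (x j) = 0) :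
    chiQ M ZK (∑ i, x i) = ∑ i, chiQ M ZK (x i) := by
  simp only [chiQ]
  rw [pairQ_sum_left, ← Finset.sum_div, ← Finset.sum_neg_distrib]
  congr 1
  refine Finset.sum_congr rfl fun i _ => ?_
  rw [pairQ_sub_right, pairQ_sub_right, pairQ_sum_right,
    Finset.sum_eq_single i (fun j _ hj => h i j hj.symm) (by simp)]

lemma toQ_sum {V : Type} {ι : Type} (s : Finset ι) (l : ι → V → ℤ) :
    toQ (∑ i ∈ s, l i) = ∑ i ∈ s, toQ (l i) := by
  funext v
  simp [toQ]

/-- Cycles supported in different components of an induced subgraph of the dual graph are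
orthogonal. -/
lemma pairQ_eq_zero_of_components_ne {V : Type} [Fintype V]
    {M : Matrix V V ℤ} (hoff : ∀ u v, u ≠ v → 0 ≤ M u v)
    {S : Set V} {c d : ((dualGraph M).induce S).ConnectedComponent} (hcd : c ≠ d)
    {l l' : V → ℤ}
    (hl : ∀ v, l v ≠ 0 → ∃ h : v ∈ S, ((dualGraph M).induce S).connectedComponentMk ⟨v, h⟩ = c)
    (hl' : ∀ v, l' v ≠ 0 → ∃ h : v ∈ S, ((dualGraph M).induce S).connectedComponentMk ⟨v, h⟩ = d) :
    pairQ M (toQ l) (toQ l') = 0 := by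
  refine Finset.sum_eq_zero fun u _ => Finset.sum_eq_zero fun v _ => ?_
  by_cases hu : l u = 0
  · simp [toQ, hu]
  by_cases hv : l' v = 0
  · simp [toQ, hv]
  obtain ⟨hu, rfl⟩ := hl u hu
  obtain ⟨hv, rfl⟩ := hl' v hv
  have huv : u ≠ v := by
    rintro rfl
    exact hcd rfl
  have hM : M u v = 0 := by
    refine le_antisymm (not_lt.mp fun hpos => hcd ?_) (hoff u v huv)
    refine SimpleGraph.ConnectedComponent.sound (SimpleGraph.Adj.reachable ?_)
    simp [dualGraph, huv, hpos]
  simp [hM]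

lemma chiQ_sum_of_components {V : Type} [Fintype V]
    {M : Matrix V V ℤ} (hoff : ∀ u v, u ≠ v → 0 ≤ M u v)
    (ZK : V → ℚ) {S : Set V} [Fintype ((dualGraph M).induce S).ConnectedComponent]
    (l : ((dualGraph M).induce S).ConnectedComponent → V → ℤ)
    (hl : ∀ c v, l c v ≠ 0 →
      ∃ h : v ∈ S, ((dualGraph M).induce S).connectedComponentMk ⟨v, h⟩ = c) :
    chiQ M ZK (toQ (∑ c, l c)) = ∑ c, chiQ M ZK (toQ (l c)) := by
  rw [toQ_sum]
  exact chiQ_sum_of_pairwise_orthogonal M ZK _ fun c d hcd =>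
    pairQ_eq_zero_of_components_ne hoff hcd (hl c) (hl d)

/-- A cycle supported in `S` is the sum of its parts on the components of the subgraph of the
dual graph induced on `S`. -/
lemma exists_eq_sum_components {V : Type} (M : Matrix V V ℤ) {S : Set V}
    [Fintype ((dualGraph M).induce S).ConnectedComponent] {l : V → ℤ} (hl0 : 0 ≤ l)
    (hlS : ∀ v, l v ≠ 0 → v ∈ S) :
    ∃ p : ((dualGraph M).induce S).ConnectedComponent → V → ℤ, (∀ c, 0 ≤ p c) ∧
      (∀ c v, p c v ≠ 0 →
        ∃ h : v ∈ S, ((dualGraph M).induce S).connectedComponentMk ⟨v, h⟩ = c) ∧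
      ∑ c, p c = l := by
  classical
  refine ⟨fun c v => if ∃ h : v ∈ S, ((dualGraph M).induce S).connectedComponentMk ⟨v, h⟩ = c
    then l v else 0, fun c v => ?_, fun c v hv => ?_, ?_⟩
  · dsimp only
    split_ifs
    · exact hl0 v
    · exact le_rfl
  · by_contra h
    exact hv (if_neg h)
  · funext v
    rw [Finset.sum_apply]
    by_cases hv : l v = 0
    · simp [hv]
    · simp [hlS v hv]

/-- Example 6.3.  Fix a vertex `v₀`, let `Γ₁,…,Γ_k` be the
connected components of the dual graph induced on `V∖{v₀}`, let `M_i` be the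
maximum of `−χ(l)` over cycles `l ≥ 0` supported in `Γ_i`, `M = Σ_i M_i`, and
let `m = min {χ(l) : l ≥ 0}`.  Then for every integer `n > −M − m`, the number
`M` is the greatest element of `{ −χ(l) − n·l_{v₀} : l ≥ 0 }`, attained by a
cycle with `l_{v₀} = 0`; equivalently
`χ(nE_{v₀}^*) − inf_{l ≥ 0} χ(nE_{v₀}^* + l) = M`. -/
theorem stmt_11
    (V : Type) [Fintype V] [DecidableEq V] [Nonempty V]
    (M : Matrix V V ℤ)
    (hsym : ∀ u v, M u v = M v u)
    (hneg : ∀ x : V → ℚ, x ≠ 0 → pairQ M x x < 0)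
    (hoff : ∀ u v : V, u ≠ v → 0 ≤ M u v)
    (hconn : (dualGraph M).Connected)
    (ZK : V → ℚ)
    (hZK : ∀ v, pairQ M ZK (Pi.single v 1) = (M v v : ℚ) + 2)
    (v₀ : V)
    -- `E_{v₀}^*` : the dual base element
    (Estar : V → ℚ)
    (hEstar : ∀ v, pairQ M Estar (Pi.single v 1) = if v = v₀ then -1 else 0)
    -- `MM c` : the maximum of `−χ(l)` over cycles `l ≥ 0` supported in the
    -- connected component `c` of the dual graph induced on `V∖{v₀}`
    (MM : ((dualGraph M).induce {v : V | v ≠ v₀}).ConnectedComponent → ℚ)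
    (hMM : ∀ c, IsGreatest {q : ℚ | ∃ l : V → ℤ, 0 ≤ l ∧
        (∀ v : V, l v ≠ 0 → ∃ h : v ≠ v₀,
          ((dualGraph M).induce {v : V | v ≠ v₀}).connectedComponentMk ⟨v, h⟩ = c) ∧
        q = -chiQ M ZK (toQ l)} (MM c))
    (Mtot : ℚ) (hMtot : Mtot = ∑ᶠ c, MM c)
    -- `m` : the minimum of `χ` over effective cycles
    (m : ℚ)
    (hm : IsLeast {q : ℚ | ∃ l : V → ℤ, 0 ≤ l ∧ q = chiQ M ZK (toQ l)} m)
    (n : ℤ) (hn : -Mtot - m < (n : ℚ)) :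
    IsGreatest {q : ℚ | ∃ l : V → ℤ, 0 ≤ l ∧
        q = -chiQ M ZK (toQ l) - (n : ℚ) * (l v₀ : ℚ)} Mtot ∧
      (∃ l : V → ℤ, 0 ≤ l ∧ l v₀ = 0 ∧ -chiQ M ZK (toQ l) = Mtot) ∧
      IsLeast {q : ℚ | ∃ l : V → ℤ, 0 ≤ l ∧
          q = chiQ M ZK (fun v => (n : ℚ) * Estar v + (l v : ℚ))}
        (chiQ M ZK (fun v => (n : ℚ) * Estar v) - Mtot) := by
  have : Fintype ((dualGraph M).induce {v : V | v ≠ v₀}).ConnectedComponent := Fintype.ofFinite _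
  rw [finsum_eq_sum_of_fintype] at hMtot
  have hattained : ∃ l : V → ℤ, 0 ≤ l ∧ l v₀ = 0 ∧ -chiQ M ZK (toQ l) = Mtot := by
    choose p hp0 hpc hpM using fun c => (hMM c).1
    refine ⟨∑ c, p c, Finset.sum_nonneg fun c _ => hp0 c, ?_, ?_⟩
    · rw [Finset.sum_apply]
      refine Finset.sum_eq_zero fun c _ => ?_
      by_contra h
      obtain ⟨h, -⟩ := hpc c v₀ h
      exact h rfl
    · rw [chiQ_sum_of_components hoff ZK p hpc, hMtot, ← Finset.sum_neg_distrib]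
      exact Finset.sum_congr rfl fun c _ => (hpM c).symm
  have hbound : ∀ l : V → ℤ, 0 ≤ l → -chiQ M ZK (toQ l) - (n : ℚ) * (l v₀ : ℚ) ≤ Mtot := by
    intro l hl
    by_cases h0 : l v₀ = 0
    · obtain ⟨p, hp0, hpc, rfl⟩ := exists_eq_sum_components M (S := {v : V | v ≠ v₀}) hl
        (by rintro v hv rfl; exact hv h0)
      rw [h0, chiQ_sum_of_components hoff ZK p hpc, hMtot, ← Finset.sum_neg_distrib]
      simp only [Int.cast_zero, mul_zero, sub_zero]
      exact Finset.sum_le_sum fun c _ => (hMM c).2 ⟨p c, hp0 c, hpc c, rfl⟩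
    · have h1 : (1 : ℚ) ≤ l v₀ := by
        have := hl v₀
        simp only [Pi.zero_apply] at this
        exact_mod_cast (by omega : (1 : ℤ) ≤ l v₀)
      have hml : m ≤ chiQ M ZK (toQ l) := hm.2 ⟨l, hl, rfl⟩
      obtain ⟨l', hl', -, hl'M⟩ := hattained
      have hml' : m ≤ chiQ M ZK (toQ l') := hm.2 ⟨l', hl', rfl⟩
      have hn0 : (0 : ℚ) < n := by linarith
      nlinarith
  have hchi : ∀ l : V → ℤ, chiQ M ZK (fun v => (n : ℚ) * Estar v + (l v : ℚ)) =
      chiQ M ZK (fun v => (n : ℚ) * Estar v) + chiQ M ZK (toQ l) + (n : ℚ) * (l v₀ : ℚ) := by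
    intro l
    have hE : pairQ M Estar (toQ l) = -(l v₀ : ℚ) := by
      rw [pairQ_eq_sum_single]
      simp [hEstar, toQ]
    have h := chiQ_add hsym ZK ((n : ℚ) • Estar) (toQ l)
    rw [pairQ_smul_left, hE, mul_neg, sub_neg_eq_add] at h
    exact h
  obtain ⟨l, hl, hl0, hlM⟩ := hattained
  refine ⟨⟨⟨l, hl, by simp [hl0, hlM]⟩, ?_⟩, ⟨l, hl, hl0, hlM⟩, ⟨l, hl, ?_⟩, ?_⟩
  · rintro _ ⟨l', hl', rfl⟩
    exact hbound l' hl'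
  · rw [hchi, hl0, ← hlM]
    simp
  · rintro _ ⟨l', hl', rfl⟩
    rw [hchi]
    linarith [hbound l' hl']
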